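/- Let γ ∈ (0,1), p > 1, A > 0, u₀ > 0, and let T_b be the blow-up time of the solution of D_c^γ u = A u^p, u(0) = u₀. Define G(p) = min(2^p, p^p/(p−1)^{p−1}) and H(p, γ) = max(p−1, 2^{−pγ/(p−1)}). Then (Γ(1+γ)/(A u₀^{p−1} G(p)))^{1/γ} ≤ T_b ≤ (Γ(1+γ)/(A u₀^{p−1} H(p, γ)))^{1/γ}. -/

import Mathlib

open MeasureTheory Real Filter Set Asymptotics
open scoped ENNReal Topology

/-- `u` is a solution of the Volterra integral form of the fractional ODE
`D_c^γ u = f(u)`, `u(0) = u₀`, on the interval `[0, T)` (with `T ∈ (0,∞]`),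
taking values in the set `D`. -/
noncomputable def IsSolUpTo (γ : ℝ) (f : ℝ → ℝ) (D : Set ℝ) (u₀ : ℝ) (u : ℝ → ℝ)
    (T : ℝ≥0∞) : Prop :=
  u 0 = u₀ ∧
  ContinuousOn u {t : ℝ | 0 ≤ t ∧ ENNReal.ofReal t < T} ∧
  (∀ t : ℝ, 0 ≤ t → ENNReal.ofReal t < T → u t ∈ D) ∧
  (∀ t : ℝ, 0 ≤ t → ENNReal.ofReal t < T →
    u t = u₀ + (1 / Real.Gamma γ) * ∫ s in (0:ℝ)..t, (t - s) ^ (γ - 1) * f (u s))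

/-- The maximal existence time `T_b`: the supremum of all `T` such that a solution
exists on `[0, T)`. -/
noncomputable def maxTime (γ : ℝ) (f : ℝ → ℝ) (D : Set ℝ) (u₀ : ℝ) : ℝ≥0∞ :=
  sSup {T : ℝ≥0∞ | ∃ u : ℝ → ℝ, IsSolUpTo γ f D u₀ u T}


/-- kernel integrability -/
lemma ker_int (γ a b t : ℝ) (hγ : 0 < γ) :
    IntervalIntegrable (fun s : ℝ => (t - s) ^ (γ - 1)) volume a b := by
  have := (intervalIntegral.intervalIntegrable_rpow' (r := γ - 1) (a := t - a) (b := t - b)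
    (by linarith)).comp_sub_left t
  simpa using this

lemma ker_integral (γ a t : ℝ) (hγ : 0 < γ) :
    ∫ s in a..t, (t - s) ^ (γ - 1) = (t - a) ^ γ / γ := by
  rw [intervalIntegral.integral_comp_sub_left (fun x => x ^ (γ - 1)) t,
    integral_rpow (Or.inl (by linarith))]
  simp [hγ.ne']

lemma ker_mul_cont (γ a b t : ℝ) (hγ : 0 < γ) (g : ℝ → ℝ) (hab : a ≤ b)
    (hg : ContinuousOn g (Icc a b)) :
    IntervalIntegrable (fun s : ℝ => (t - s) ^ (γ - 1) * g s) volume a b :=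
  (ker_int γ a b t hγ).mul_continuousOn (by rwa [uIcc_of_le hab])

lemma ker_mul_mono (γ a b t M : ℝ) (hγ : 0 < γ) (h : ℝ → ℝ) (hm : Monotone h)
    (h0 : ∀ s, 0 ≤ h s) (hM : ∀ s, h s ≤ M) :
    IntervalIntegrable (fun s : ℝ => (t - s) ^ (γ - 1) * h s) volume a b := by
  have hk := ker_int γ a b t hγ
  rw [intervalIntegrable_iff] at hk ⊢
  refine Integrable.mul_bdd (c := M) hk hm.measurable.aestronglyMeasurable ?_
  filter_upwards with s
  rw [Real.norm_of_nonneg (h0 s)]; exact hM s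

lemma J_le (γ a t M : ℝ) (hγ : 0 < γ) (hat : a ≤ t) (h : ℝ → ℝ)
    (hi : IntervalIntegrable (fun s : ℝ => (t - s) ^ (γ - 1) * h s) volume a t)
    (hM : ∀ s ∈ Icc a t, h s ≤ M) :
    ∫ s in a..t, (t - s) ^ (γ - 1) * h s ≤ M * ((t - a) ^ γ / γ) := by
  rw [← ker_integral γ a t hγ, ← intervalIntegral.integral_const_mul]
  refine intervalIntegral.integral_mono_on hat hi ((ker_int γ a t t hγ).const_mul M) ?_
  intro s hs
  have : 0 ≤ (t - s) ^ (γ - 1) := Real.rpow_nonneg (by linarith [hs.2]) _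
  nlinarith [hM s hs]

lemma le_J (γ a t M : ℝ) (hγ : 0 < γ) (hat : a ≤ t) (h : ℝ → ℝ)
    (hi : IntervalIntegrable (fun s : ℝ => (t - s) ^ (γ - 1) * h s) volume a t)
    (hM : ∀ s ∈ Icc a t, M ≤ h s) :
    M * ((t - a) ^ γ / γ) ≤ ∫ s in a..t, (t - s) ^ (γ - 1) * h s := by
  rw [← ker_integral γ a t hγ, ← intervalIntegral.integral_const_mul]
  refine intervalIntegral.integral_mono_on hat ((ker_int γ a t t hγ).const_mul M) hi ?_
  intro s hs
  have : 0 ≤ (t - s) ^ (γ - 1) := Real.rpow_nonneg (by linarith [hs.2]) _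
  nlinarith [hM s hs]

lemma J_nonneg (γ a t : ℝ) (hat : a ≤ t) (h : ℝ → ℝ) (h0 : ∀ s ∈ Icc a t, 0 ≤ h s) :
    0 ≤ ∫ s in a..t, (t - s) ^ (γ - 1) * h s :=
  intervalIntegral.integral_nonneg hat fun s hs =>
    mul_nonneg (Real.rpow_nonneg (by linarith [hs.2]) _) (h0 s hs)

lemma J_mono_t (γ t t' M : ℝ) (hγ : 0 < γ) (ht : 0 ≤ t) (htt : t ≤ t') (h : ℝ → ℝ)
    (hm : Monotone h) (h0 : ∀ s, 0 ≤ h s) (hM : ∀ s, h s ≤ M) :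
    ∫ s in (0:ℝ)..t, (t - s) ^ (γ - 1) * h s ≤ ∫ s in (0:ℝ)..t', (t' - s) ^ (γ - 1) * h s := by
  have hi' := ker_mul_mono γ 0 (t' - t) t' M hγ h hm h0 hM
  have hi'' := ker_mul_mono γ (t' - t) t' t' M hγ h hm h0 hM
  rw [← intervalIntegral.integral_add_adjacent_intervals hi' hi'']
  have e : ∫ s in (0:ℝ)..t, (t - s) ^ (γ - 1) * h s =
      ∫ s in (t' - t)..t', (t' - s) ^ (γ - 1) * h (s - (t' - t)) := by
    have := intervalIntegral.integral_comp_sub_right (a := t' - t) (b := t')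
      (fun s => (t - s) ^ (γ - 1) * h s) (t' - t)
    simp only [sub_self, sub_sub_cancel] at this
    rw [← this]
    congr 1; ext s; congr 2; ring
  have h1 : 0 ≤ ∫ s in (0:ℝ)..(t' - t), (t' - s) ^ (γ - 1) * h s :=
    intervalIntegral.integral_nonneg (by linarith) fun s hs =>
      mul_nonneg (Real.rpow_nonneg (by linarith [hs.2]) _) (h0 s)
  have h2 : ∫ s in (t' - t)..t', (t' - s) ^ (γ - 1) * h (s - (t' - t)) ≤
      ∫ s in (t' - t)..t', (t' - s) ^ (γ - 1) * h s := by
    refine intervalIntegral.integral_mono_on (by linarith) ?_ hi'' ?_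
    · exact ker_mul_mono γ _ _ t' M hγ (fun s => h (s - (t' - t)))
        (fun x y hxy => hm (by linarith)) (fun s => h0 _) (fun s => hM _)
    · intro s hs
      exact mul_le_mul_of_nonneg_left (hm (by linarith))
        (Real.rpow_nonneg (by linarith [hs.2]) _)
  linarith

lemma J_holder (γ t t' M : ℝ) (hγ : 0 < γ) (hγ1 : γ < 1) (ht : 0 ≤ t) (htt : t ≤ t') (h : ℝ → ℝ)
    (hm : Monotone h) (h0 : ∀ s, 0 ≤ h s) (hM : ∀ s, h s ≤ M) :
    ∫ s in (0:ℝ)..t', (t' - s) ^ (γ - 1) * h s ≤ 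
      (∫ s in (0:ℝ)..t, (t - s) ^ (γ - 1) * h s) + M * ((t' - t) ^ γ / γ) := by
  have hi' := ker_mul_mono γ 0 t t' M hγ h hm h0 hM
  have hi'' := ker_mul_mono γ t t' t' M hγ h hm h0 hM
  rw [← intervalIntegral.integral_add_adjacent_intervals hi' hi'']
  refine add_le_add ?_ (J_le γ t t' M hγ htt h hi'' fun s _ => hM s)
  refine intervalIntegral.integral_mono_on_of_le_Ioo ht hi' (ker_mul_mono γ 0 t t M hγ h hm h0 hM) ?_
  intro s hs
  refine mul_le_mul_of_nonneg_right ?_ (h0 s)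
  exact Real.rpow_le_rpow_of_nonpos (by linarith [hs.2]) (by linarith) (by linarith)

/-- existence up to `T` when `[u₀, L]` is invariant -/
lemma exist_sol (γ p A u₀ L T : ℝ) (hγ : 0 < γ) (hγ1 : γ < 1) (hp : 0 < p) (hA : 0 < A)
    (hu₀ : 0 < u₀) (hL : u₀ ≤ L) (hT : 0 ≤ T)
    (hinv : u₀ + (1 / Real.Gamma γ) * ((A * L ^ p) * (T ^ γ / γ)) ≤ L) :
    ∃ u, IsSolUpTo γ (fun x => A * x ^ p) (Set.Ioi 0) u₀ u (ENNReal.ofReal T) := by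
  have hG : 0 < Real.Gamma γ := Real.Gamma_pos_of_pos hγ
  have : Fact (u₀ ≤ L) := ⟨hL⟩
  let h : (ℝ →o Icc u₀ L) → ℝ → ℝ := fun g s => A * (g s : ℝ) ^ p
  have hpos : ∀ (g : ℝ →o Icc u₀ L) s, 0 < (g s : ℝ) := fun g s => hu₀.trans_le (g s).2.1
  have hh0 : ∀ g s, 0 ≤ h g s := fun g s => by have := hpos g s; positivity
  have hhM : ∀ g s, h g s ≤ A * L ^ p := fun g s =>
    mul_le_mul_of_nonneg_left (Real.rpow_le_rpow (hpos g s).le (g s).2.2 hp.le) hA.le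
  have hhm : ∀ g, Monotone (h g) := fun g x y hxy =>
    mul_le_mul_of_nonneg_left (Real.rpow_le_rpow (hpos g x).le (g.monotone hxy) hp.le) hA.le
  have hM0 : 0 ≤ A * L ^ p := by have := hu₀.trans_le hL; positivity
  let τ : ℝ → ℝ := fun t => max 0 (min t T)
  have hτ0 : ∀ t, 0 ≤ τ t := fun t => le_max_left _ _
  have hτT : ∀ t, τ t ≤ T := fun t => max_le hT (min_le_right _ _)
  have hτm : Monotone τ := fun x y hxy => max_le_max le_rfl (min_le_min hxy le_rfl)
  let J : (ℝ →o Icc u₀ L) → ℝ → ℝ := fun g t => ∫ s in (0:ℝ)..t, (t - s) ^ (γ - 1) * h g s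
  have hJ0 : ∀ g t, 0 ≤ t → 0 ≤ J g t := fun g t ht => J_nonneg γ 0 t ht _ fun s _ => hh0 g s
  have hJL : ∀ g t, 0 ≤ t → t ≤ T → u₀ + (1 / Real.Gamma γ) * J g t ≤ L := by
    intro g t ht htT
    have h1 : J g t ≤ (A * L ^ p) * (T ^ γ / γ) := by
      refine (J_le γ 0 t (A * L ^ p) hγ ht (h g) (ker_mul_mono γ 0 t t _ hγ _ (hhm g) (hh0 g) (hhM g)) 
        fun s _ => hhM g s).trans ?_
      rw [sub_zero]; gcongr
    have : (1 / Real.Gamma γ) * J g t ≤ (1 / Real.Gamma γ) * ((A * L ^ p) * (T ^ γ / γ)) := by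
      gcongr
    linarith
  let Φ : (ℝ →o Icc u₀ L) →o (ℝ →o Icc u₀ L) :=
    { toFun := fun g =>
        { toFun := fun t => ⟨u₀ + (1 / Real.Gamma γ) * J g (τ t), by
            constructor
            · have := mul_nonneg (one_div_pos.2 hG).le (hJ0 g (τ t) (hτ0 t)); linarith
            · exact hJL g _ (hτ0 t) (hτT t)⟩
          monotone' := by
            intro x y hxy
            change u₀ + (1 / Real.Gamma γ) * J g (τ x) ≤ u₀ + (1 / Real.Gamma γ) * J g (τ y)
            have : J g (τ x) ≤ J g (τ y) :=
              J_mono_t γ _ _ _ hγ (hτ0 x) (hτm hxy) _ (hhm g) (hh0 g) (hhM g)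
            gcongr }
      monotone' := by
        intro g g' hgg t
        change u₀ + (1 / Real.Gamma γ) * J g (τ t) ≤ u₀ + (1 / Real.Gamma γ) * J g' (τ t)
        have : J g (τ t) ≤ J g' (τ t) := by
          refine intervalIntegral.integral_mono_on (hτ0 t) 
            (ker_mul_mono γ _ _ _ _ hγ _ (hhm g) (hh0 g) (hhM g))
            (ker_mul_mono γ _ _ _ _ hγ _ (hhm g') (hh0 g') (hhM g')) ?_
          intro s hs
          refine mul_le_mul_of_nonneg_left ?_ (Real.rpow_nonneg (by linarith [hs.2]) _)
          have : (g s : ℝ) ≤ g' s := hgg s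
          exact mul_le_mul_of_nonneg_left (Real.rpow_le_rpow (hpos g s).le this hp.le) hA.le
        gcongr }
  let g : ℝ →o Icc u₀ L := OrderHom.lfp (α := ℝ →o Icc u₀ L) Φ
  have hfix : Φ g = g := OrderHom.map_lfp (α := ℝ →o Icc u₀ L) Φ
  have heq : ∀ t, (g t : ℝ) = u₀ + (1 / Real.Gamma γ) * J g (τ t) := by
    intro t
    conv_lhs => rw [← hfix]
    rfl
  have hτe : ∀ t, 0 ≤ t → ENNReal.ofReal t < ENNReal.ofReal T → τ t = t := by
    intro t ht htT
    have : t < T := (ENNReal.ofReal_lt_ofReal_iff_of_nonneg ht).1 htT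
    simp [τ, ht, this.le]
  refine ⟨fun t => g t, ?_, ?_, fun t _ _ => hpos g t, ?_⟩
  · change (g 0 : ℝ) = u₀
    rw [heq]; simp [τ, hT, J]
  · apply Continuous.continuousOn
    let C : ℝ := (1 / Real.Gamma γ) * ((A * L ^ p) / γ)
    have hC : 0 ≤ C := by positivity
    have key : ∀ x y, x ≤ y → (g y : ℝ) - g x ≤ C * (y - x) ^ γ := by
      intro x y hxy
      rw [heq, heq]
      have h1 : J g (τ y) ≤ J g (τ x) + (A * L ^ p) * ((τ y - τ x) ^ γ / γ) :=
        J_holder γ _ _ _ hγ hγ1 (hτ0 x) (hτm hxy) _ (hhm g) (hh0 g) (hhM g)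
      have h2 : τ y - τ x ≤ y - x := by
        simp only [τ]
        rcases max_cases 0 (min y T) with h | h <;> rcases max_cases 0 (min x T) with h' | h' <;>
        rcases min_cases y T with h'' | h'' <;> rcases min_cases x T with h3 | h3 <;> linarith
      have h3 : (τ y - τ x) ^ γ ≤ (y - x) ^ γ :=
        Real.rpow_le_rpow (sub_nonneg.2 (hτm hxy)) h2 hγ.le
      have h4 : (1 / Real.Gamma γ) * J g (τ y) ≤ 
          (1 / Real.Gamma γ) * (J g (τ x) + (A * L ^ p) * ((y - x) ^ γ / γ)) := by
        gcongr
        refine h1.trans ?_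
        gcongr
      have : C * (y - x) ^ γ = (1 / Real.Gamma γ) * ((A * L ^ p) * ((y - x) ^ γ / γ)) := by
        simp only [C]; ring
      rw [this]
      linarith
    have key2 : ∀ x y, |(g y : ℝ) - g x| ≤ C * |y - x| ^ γ := by
      intro x y
      rcases le_total x y with hxy | hxy
      · have : (g x : ℝ) ≤ g y := g.monotone hxy
        rw [abs_of_nonneg (by linarith), abs_of_nonneg (by linarith)]
        exact key x y hxy
      · have : (g y : ℝ) ≤ g x := g.monotone hxy
        rw [abs_sub_comm, abs_sub_comm y x, abs_of_nonneg (by linarith), abs_of_nonneg (by linarith)]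
        exact key y x hxy
    rw [continuous_iff_continuousAt]
    intro x
    rw [ContinuousAt, tendsto_iff_dist_tendsto_zero]
    refine squeeze_zero (fun _ => dist_nonneg) (fun y => key2 x y) ?_
    have : Continuous fun y : ℝ => C * |y - x| ^ γ :=
      continuous_const.mul ((continuous_abs.comp (continuous_id.sub continuous_const)).rpow_const
        fun _ => Or.inr hγ.le)
    have := this.tendsto x
    simpa [hγ.ne'] using this
  · intro t ht htT
    change (g t : ℝ) = _
    rw [heq, hτe t ht htT]
/-- Doubling argument: for every solution on `[0,T)`. -/
lemma upper_two (γ p A u₀ S : ℝ) (hγ : 0 < γ) (hp : 1 < p) (hA : 0 < A) (hu₀ : 0 < u₀)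
    (hS0 : 0 < S)
    (hS : A * u₀ ^ (p - 1) * S ^ γ = Real.Gamma (1 + γ) * (2:ℝ) ^ (p * γ / (p - 1)))
    (T : ℝ≥0∞) (u : ℝ → ℝ) (hu : IsSolUpTo γ (fun x => A * x ^ p) (Set.Ioi 0) u₀ u T) :
    T ≤ ENNReal.ofReal S := by
  by_contra! hlt
  obtain ⟨h0, hc, hD, he⟩ := hu
  have hG : 0 < Real.Gamma γ := Real.Gamma_pos_of_pos hγ
  have hG1 : Real.Gamma (1 + γ) = γ * Real.Gamma γ := by
    rw [add_comm]; exact Real.Gamma_add_one hγ.ne'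
  have hin : ∀ t, t ≤ S → ENNReal.ofReal t < T := fun t ht =>
    (ENNReal.ofReal_le_ofReal ht).trans_lt hlt
  have hc' : ContinuousOn u (Icc 0 S) := hc.mono fun t ht => ⟨ht.1, hin t ht.2⟩
  have hpos : ∀ t ∈ Icc 0 S, 0 < u t := fun t ht => hD t ht.1 (hin t ht.2)
  have hfc : ContinuousOn (fun s => A * u s ^ p) (Icc 0 S) :=
    continuousOn_const.mul (hc'.rpow_const fun s hs => Or.inl (hpos s hs).ne')
  have hp1 : 0 < p - 1 := by linarith
  let q : ℝ := (2:ℝ) ^ (γ / (p - 1))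
  have hq : 1 < q := Real.one_lt_rpow (by norm_num) (by positivity)
  have key : ∀ n : ℕ, ∀ t ∈ Icc (S * (1 - (1/2) ^ n)) S, u₀ * q ^ n ≤ u t := by
    intro n
    induction n with
    | zero =>
      intro t ht
      have ht0 : 0 ≤ t := by simpa using ht.1
      rw [he t ht0 (hin t ht.2)]
      have := J_nonneg γ 0 t ht0 (fun s => A * u s ^ p) (fun s hs => by
        have := hpos s ⟨hs.1, hs.2.trans ht.2⟩; positivity)
      have := mul_nonneg (one_div_pos.2 hG).le this
      simp only [pow_zero, mul_one]
      linarith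
    | succ n ih =>
      intro t ht
      set a := S * (1 - (1/2) ^ n) with ha
      have hpn : (0:ℝ) < (1/2) ^ n := by positivity
      have hpn1 : ((1:ℝ)/2) ^ n ≤ 1 := pow_le_one₀ (by norm_num) (by norm_num)
      have ha0 : 0 ≤ a := mul_nonneg hS0.le (by linarith)
      have hta : S * (1/2)^(n+1) ≤ t - a := by
        have := ht.1
        rw [ha]; rw [pow_succ] at this ⊢; linarith
      have hat : a ≤ t := by
        have : 0 ≤ S * (1/2)^(n+1) := by positivity
        linarith
      have ht0 := ha0.trans hat
      rw [he t ht0 (hin t ht.2)]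
      have hi1 := ker_mul_cont γ 0 a t hγ (fun s => A * u s ^ p) ha0
        (hfc.mono (Icc_subset_Icc le_rfl (hat.trans ht.2)))
      have hi2 := ker_mul_cont γ a t t hγ (fun s => A * u s ^ p) hat
        (hfc.mono (Icc_subset_Icc ha0 ht.2))
      rw [← intervalIntegral.integral_add_adjacent_intervals hi1 hi2]
      have h1 : 0 ≤ ∫ s in (0:ℝ)..a, (t - s) ^ (γ - 1) * (A * u s ^ p) :=
        intervalIntegral.integral_nonneg ha0 fun s hs => by
          have := hpos s ⟨hs.1, hs.2.trans (hat.trans ht.2)⟩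
          have := Real.rpow_nonneg (show 0 ≤ t - s by linarith [hs.2]) (γ - 1)
          positivity
      have h2 := le_J γ a t (A * (u₀ * q ^ n) ^ p) hγ hat (fun s => A * u s ^ p) hi2 (by
        intro s hs
        have := ih s ⟨hs.1, hs.2.trans ht.2⟩
        gcongr)
      have h3 : (S * (1/2)^(n+1)) ^ γ ≤ (t - a) ^ γ :=
        Real.rpow_le_rpow (by positivity) hta hγ.le
      have h4 : u₀ * q ^ (n+1) = 
          (1 / Real.Gamma γ) * (A * (u₀ * q ^ n) ^ p * ((S * (1/2)^(n+1)) ^ γ / γ)) := by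
        have e1 : A * (u₀ * q ^ n) ^ p * (S * (1/2)^(n+1)) ^ γ = 
            Real.Gamma (1 + γ) * (u₀ * q ^ (n+1)) := by
          have e2 : u₀ ^ p = u₀ ^ (p - 1) * u₀ := by
            rw [← Real.rpow_add_one hu₀.ne']; ring_nf
          have e3 : (q ^ n) ^ p = (2:ℝ) ^ (γ / (p - 1) * n * p) := by
            rw [← Real.rpow_natCast, ← Real.rpow_mul (by positivity), ← Real.rpow_mul (by norm_num),
              mul_assoc]
          have e4 : (((1:ℝ)/2)^(n+1)) ^ γ = (2:ℝ) ^ (-((n:ℝ) + 1) * γ) := by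
            rw [one_div, inv_pow, ← Real.rpow_natCast, ← Real.rpow_neg (by norm_num),
              ← Real.rpow_mul (by norm_num)]
            push_cast; rfl
          have e5 : q ^ (n+1) = (2:ℝ) ^ (γ / (p - 1) * ((n:ℝ) + 1)) := by
            rw [← Real.rpow_natCast, ← Real.rpow_mul (by norm_num)]
            push_cast; rfl
          rw [Real.mul_rpow hu₀.le (by positivity), Real.mul_rpow hS0.le (by positivity), e2, e3,
            e4, e5]
          calc A * (u₀ ^ (p - 1) * u₀ * (2:ℝ) ^ (γ / (p - 1) * n * p)) * 
                (S ^ γ * (2:ℝ) ^ (-((n:ℝ) + 1) * γ))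
              = (A * u₀ ^ (p - 1) * S ^ γ) * u₀ * ((2:ℝ) ^ (γ / (p - 1) * n * p) *
                (2:ℝ) ^ (-((n:ℝ) + 1) * γ)) := by ring
            _ = Real.Gamma (1 + γ) * (u₀ * ((2:ℝ) ^ (p * γ / (p - 1)) * 
                  ((2:ℝ) ^ (γ / (p - 1) * n * p) * (2:ℝ) ^ (-((n:ℝ) + 1) * γ)))) := by
                rw [hS]; ring
            _ = _ := by
                rw [← Real.rpow_add (by norm_num), ← Real.rpow_add (by norm_num)]
                congr 3
                field_simp
                ring
        rw [← mul_div_assoc, e1, hG1]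
        field_simp
      rw [h4]
      have h5 : (1 / Real.Gamma γ) * (A * (u₀ * q ^ n) ^ p * ((S * (1/2)^(n+1)) ^ γ / γ)) ≤
          (1 / Real.Gamma γ) * ((∫ s in (0:ℝ)..a, (t - s) ^ (γ - 1) * (A * u s ^ p)) +
            ∫ s in a..t, (t - s) ^ (γ - 1) * (A * u s ^ p)) := by
        gcongr
        refine le_trans ?_ (h2.trans (le_add_of_nonneg_left h1))
        gcongr
      linarith
  obtain ⟨n, hn⟩ := pow_unbounded_of_one_lt (u S / u₀) hq
  rw [div_lt_iff₀ hu₀] at hn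
  have := key n S ⟨by
    have : (0:ℝ) < (1/2)^n := by positivity
    nlinarith, le_rfl⟩
  linarith

/-- Chebyshev type inequality -/
lemma cheb (γ t : ℝ) (hγ : 0 < γ) (hγ1 : γ < 1) (ht : 0 < t) (g : ℝ → ℝ)
    (hg : ContinuousOn g (Icc 0 t)) (hm : MonotoneOn g (Icc 0 t)) :
    ∫ s in (0:ℝ)..t, s ^ (γ - 1) * g s ≤ ∫ s in (0:ℝ)..t, (t - s) ^ (γ - 1) * g s := by
  have hi1 : IntervalIntegrable (fun s : ℝ => s ^ (γ - 1)) volume 0 t :=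
    intervalIntegral.intervalIntegrable_rpow' (by linarith)
  have hi2 := ker_int γ 0 t t hγ
  have hi1g : IntervalIntegrable (fun s : ℝ => s ^ (γ - 1) * g s) volume 0 t :=
    hi1.mul_continuousOn (by rwa [uIcc_of_le ht.le])
  have hi2g := ker_mul_cont γ 0 t t hγ g ht.le hg
  have hz : ∫ s in (0:ℝ)..t, ((t - s) ^ (γ - 1) - s ^ (γ - 1)) * g (t/2) = 0 := by
    rw [intervalIntegral.integral_mul_const, intervalIntegral.integral_sub hi2 hi1,
      ker_integral γ 0 t hγ, integral_rpow (Or.inl (by linarith))]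
    simp [hγ.ne']
  have hmain : ∫ s in (0:ℝ)..t, ((t - s) ^ (γ - 1) - s ^ (γ - 1)) * g (t/2) ≤
      ∫ s in (0:ℝ)..t, ((t - s) ^ (γ - 1) * g s - s ^ (γ - 1) * g s) := by
    refine intervalIntegral.integral_mono_on_of_le_Ioo ht.le ((hi2.sub hi1).mul_const _)
      (hi2g.sub hi1g) ?_
    intro s hs
    have hsI : s ∈ Icc 0 t := ⟨hs.1.le, hs.2.le⟩
    have htI : t/2 ∈ Icc 0 t := ⟨by linarith, by linarith⟩
    rcases le_total s (t/2) with h | h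
    · have h1 := hm hsI htI h
      have h2 : (t - s) ^ (γ - 1) ≤ s ^ (γ - 1) :=
        Real.rpow_le_rpow_of_nonpos hs.1 (by linarith) (by linarith)
      nlinarith
    · have h1 := hm htI hsI h
      have h2 : s ^ (γ - 1) ≤ (t - s) ^ (γ - 1) :=
        Real.rpow_le_rpow_of_nonpos (by linarith [hs.2]) (by linarith) (by linarith)
      nlinarith
  rw [hz, intervalIntegral.integral_sub hi2g hi1g] at hmain
  linarith

/-- comparison with an explicit subsolution -/
lemma upper_p (γ p A u₀ S : ℝ) (hγ : 0 < γ) (hγ1 : γ < 1) (hp : 1 < p) (hA : 0 < A) (hu₀ : 0 < u₀)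
    (hS0 : 0 < S)
    (hS : A * u₀ ^ (p - 1) * (p - 1) * S ^ γ = Real.Gamma (1 + γ))
    (T : ℝ≥0∞) (u : ℝ → ℝ) (hu : IsSolUpTo γ (fun x => A * x ^ p) (Set.Ioi 0) u₀ u T) :
    T ≤ ENNReal.ofReal S := by
  by_contra! hlt
  obtain ⟨h0, hc, hD, he⟩ := hu
  have hG : 0 < Real.Gamma γ := Real.Gamma_pos_of_pos hγ
  have hG1 : Real.Gamma (1 + γ) = γ * Real.Gamma γ := by
    rw [add_comm]; exact Real.Gamma_add_one hγ.ne'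
  have hp1 : 0 < p - 1 := by linarith
  obtain ⟨R, hSR, hRT⟩ : ∃ R : ℝ, S < R ∧ ENNReal.ofReal R < T := by
    obtain ⟨r, hr0, h1, h2⟩ := ENNReal.lt_iff_exists_real_btwn.1 hlt
    exact ⟨r, (ENNReal.ofReal_lt_ofReal_iff_of_nonneg hS0.le).1 h1, h2⟩
  have hR0 : 0 < R := hS0.trans hSR
  have hin : ∀ t, t ≤ R → ENNReal.ofReal t < T := fun t ht =>
    (ENNReal.ofReal_le_ofReal ht).trans_lt hRT
  have hc' : ContinuousOn u (Icc 0 R) := hc.mono fun t ht => ⟨ht.1, hin t ht.2⟩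
  have hpos : ∀ t ∈ Icc 0 R, 0 < u t := fun t ht => hD t ht.1 (hin t ht.2)
  have hfc : ContinuousOn (fun s => A * u s ^ p) (Icc 0 R) :=
    continuousOn_const.mul (hc'.rpow_const fun s hs => Or.inl (hpos s hs).ne')
  have hG1p : 0 < Real.Gamma (1 + γ) := by rw [hG1]; positivity
  let k : ℝ := (p - 1) * A / Real.Gamma (1 + γ)
  have hk : 0 < k := by positivity
  let z : ℝ → ℝ := fun s => k * (R ^ γ - s ^ γ)
  let v : ℝ → ℝ := fun s => z s ^ (-(1 / (p - 1)))
  have hzc : Continuous z := continuous_const.mul (continuous_const.sub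
    (Real.continuous_rpow_const hγ.le))
  have hzpos : ∀ s, 0 ≤ s → s < R → 0 < z s := fun s hs hsR =>
    mul_pos hk (sub_pos.2 (Real.rpow_lt_rpow hs hsR hγ))
  have hvpos : ∀ s, 0 ≤ s → s < R → 0 < v s := fun s hs hsR => Real.rpow_pos_of_pos (hzpos s hs hsR) _
  have hvc : ∀ b, b < R → ContinuousOn v (Icc 0 b) := fun b hb =>
    hzc.continuousOn.rpow_const fun s hs => Or.inl (hzpos s hs.1 (hs.2.trans_lt hb)).ne'
  have hvm : ∀ b, b < R → MonotoneOn v (Icc 0 b) := by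
    intro b hb x hx y hy hxy
    refine Real.rpow_le_rpow_of_nonpos (hzpos y hy.1 (hy.2.trans_lt hb)) ?_ 
      (by rw [neg_nonpos]; positivity)
    have : x ^ γ ≤ y ^ γ := Real.rpow_le_rpow hx.1 hxy hγ.le
    simp only [z]; gcongr
  -- initial comparison
  have hv0 : v 0 < u₀ := by
    have e : u₀ = (u₀ ^ (-(p - 1))) ^ (-(1 / (p - 1))) := by
      rw [← Real.rpow_mul hu₀.le]
      have : -(p - 1) * -(1 / (p - 1)) = 1 := by field_simp
      rw [this, Real.rpow_one]
    rw [e]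
    refine Real.rpow_lt_rpow_of_neg (by positivity) ?_ (by rw [neg_lt_zero]; positivity)
    have h1 : S ^ γ < R ^ γ := Real.rpow_lt_rpow hS0.le hSR hγ
    have h2 : u₀ ^ (-(p - 1)) = k * S ^ γ := by
      rw [Real.rpow_neg hu₀.le]
      have : 0 < u₀ ^ (p - 1) := by positivity
      simp only [k]
      rw [← hS]
      have : 0 < S ^ γ := by positivity
      field_simp
    rw [h2]
    simp only [z, Real.zero_rpow hγ.ne', sub_zero]
    gcongr
  -- subsolution
  have hsub : ∀ t, 0 < t → t < R → v t ≤ v 0 + (1 / Real.Gamma γ) * 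
      ∫ s in (0:ℝ)..t, (t - s) ^ (γ - 1) * (A * v s ^ p) := by
    intro t ht htR
    have hgc : ContinuousOn (fun s => A * v s ^ p) (Icc 0 t) :=
      continuousOn_const.mul ((hvc t htR).rpow_const fun s hs =>
        Or.inl (hvpos s hs.1 (hs.2.trans_lt htR)).ne')
    have hgm : MonotoneOn (fun s => A * v s ^ p) (Icc 0 t) := by
      intro x hx y hy hxy
      have := hvm t htR hx hy hxy
      have := hvpos x hx.1 (hx.2.trans_lt htR)
      simp only
      gcongr
    have hch := cheb γ t hγ hγ1 ht _ hgc hgm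
    have hii : IntervalIntegrable (fun s : ℝ => s ^ (γ - 1) * (A * v s ^ p)) volume 0 t :=
      (intervalIntegral.intervalIntegrable_rpow' (by linarith)).mul_continuousOn
        (by rwa [uIcc_of_le ht.le])
    have hftc : ∫ s in (0:ℝ)..t, (1 / Real.Gamma γ) * (s ^ (γ - 1) * (A * v s ^ p)) = v t - v 0 := by
      refine intervalIntegral.integral_eq_sub_of_hasDerivAt_of_le ht.le (hvc t htR) ?_ (hii.const_mul _)
      intro s hs
      have hzs := hzpos s hs.1.le (hs.2.trans htR)
      have hd : HasDerivAt z (k * (0 - γ * s ^ (γ - 1))) s :=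
        ((hasDerivAt_const s (R ^ γ)).sub
          (Real.hasDerivAt_rpow_const (Or.inl hs.1.ne'))).const_mul k
      have hd2 := hd.rpow_const (p := -(1 / (p - 1))) (Or.inl hzs.ne')
      have e : v s ^ p = z s ^ (-(1 / (p - 1)) - 1) := by
        simp only [v]
        rw [← Real.rpow_mul hzs.le]
        congr 1
        field_simp
        ring
      have e' : (1 / Real.Gamma γ) * (s ^ (γ - 1) * (A * v s ^ p)) =
          k * (0 - γ * s ^ (γ - 1)) * -(1 / (p - 1)) * z s ^ (-(1 / (p - 1)) - 1) := by
        rw [e]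
        simp only [k, hG1]
        field_simp
        try ring
      rw [e']
      exact hd2
    rw [intervalIntegral.integral_const_mul] at hftc
    have := mul_le_mul_of_nonneg_left hch (one_div_pos.2 hG).le
    linarith
  -- comparison
  have hcomp : ∀ b, 0 ≤ b → b < R → v b < u b := by
    intro b hb0 hbR
    by_contra! hle
    have hcu : ContinuousOn u (Icc 0 b) := hc'.mono (Icc_subset_Icc le_rfl hbR.le)
    let K := {x ∈ Icc 0 b | u x ≤ v x}
    have hKc : IsClosed K := isClosed_Icc.isClosed_le hcu (hvc b hbR)
    have hKK : IsCompact K := isCompact_Icc.of_isClosed_subset hKc (fun x hx => hx.1)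
    obtain ⟨t, htK, htmin⟩ := hKK.exists_isLeast ⟨b, ⟨hb0, le_rfl⟩, hle⟩
    have htb : t ≤ b := htK.1.2
    have htR : t < R := htb.trans_lt hbR
    have ht0 : 0 < t := by
      rcases htK.1.1.eq_or_lt with h | h
      · exfalso
        have := htK.2
        rw [← h, h0] at this
        linarith
      · exact h
    have hlt' : ∀ s, 0 ≤ s → s < t → v s < u s := by
      intro s hs hst
      by_contra! hh
      exact absurd (htmin ⟨⟨hs, hst.le.trans htb⟩, hh⟩) (not_le.2 hst)
    have h1 := hsub t ht0 htR
    have h2 := he t ht0.le (hin t htR.le)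
    have h3 : ∫ s in (0:ℝ)..t, (t - s) ^ (γ - 1) * (A * v s ^ p) ≤
        ∫ s in (0:ℝ)..t, (t - s) ^ (γ - 1) * (A * u s ^ p) := by
      refine intervalIntegral.integral_mono_on_of_le_Ioo ht0.le 
        (ker_mul_cont γ 0 t t hγ _ ht0.le ?_) (ker_mul_cont γ 0 t t hγ _ ht0.le ?_) ?_
      · exact continuousOn_const.mul ((hvc t htR).rpow_const fun s hs =>
          Or.inl (hvpos s hs.1 (hs.2.trans_lt htR)).ne')
      · exact hfc.mono (Icc_subset_Icc le_rfl htR.le)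
      · intro s hs
        have ha := hlt' s hs.1.le hs.2
        have hb := hvpos s hs.1.le (hs.2.trans htR)
        have hc := Real.rpow_nonneg (show 0 ≤ t - s by linarith [hs.2]) (γ - 1)
        gcongr
    have h4 := mul_le_mul_of_nonneg_left h3 (one_div_pos.2 hG).le
    have h5 := htK.2
    simp only at h2
    linarith
  -- blow up
  obtain ⟨M, hM⟩ := isCompact_Icc.bddAbove_image hc'
  have hMu : ∀ t ∈ Icc 0 R, u t ≤ M := fun t ht => hM ⟨t, ht, rfl⟩
  have hM0 : 0 < M := (hpos 0 ⟨le_rfl, hR0.le⟩).trans_le (hMu 0 ⟨le_rfl, hR0.le⟩)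
  have hzR : z R < M ^ (-(p - 1)) := by
    simp only [z, sub_self, mul_zero]; positivity
  have hev : ∀ᶠ s in 𝓝[<] R, z s < M ^ (-(p - 1)) :=
    nhdsWithin_le_nhds (hzc.continuousAt.eventually_lt continuousAt_const hzR)
  have hev2 : ∀ᶠ s in 𝓝[<] R, s ∈ Ioo 0 R := Ioo_mem_nhdsLT hR0
  obtain ⟨s, hs1, hs2⟩ := (hev.and hev2).exists
  have h1 : (M ^ (-(p - 1))) ^ (-(1 / (p - 1))) < v s :=
    Real.rpow_lt_rpow_of_neg (hzpos s hs2.1.le hs2.2) hs1 (by rw [neg_lt_zero]; positivity)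
  rw [← Real.rpow_mul hM0.le, show -(p - 1) * -(1 / (p - 1)) = 1 by field_simp, Real.rpow_one] at h1
  have := hcomp s hs2.1.le hs2.2
  have := hMu s ⟨hs2.1.le, hs2.2.le⟩
  linarith

/-- existence from an amplification factor -/
lemma lower_lam (γ p A u₀ l G : ℝ) (hγ : 0 < γ) (hγ1 : γ < 1) (hp : 1 < p) (hA : 0 < A)
    (hu₀ : 0 < u₀) (hl : 1 < l) (hG : l ^ p / (l - 1) = G) :
    ENNReal.ofReal ((Real.Gamma (1 + γ) / (A * u₀ ^ (p - 1) * G)) ^ (1 / γ)) ≤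
      maxTime γ (fun x => A * x ^ p) (Set.Ioi 0) u₀ := by
  have hGa : 0 < Real.Gamma γ := Real.Gamma_pos_of_pos hγ
  have hG1 : Real.Gamma (1 + γ) = γ * Real.Gamma γ := by
    rw [add_comm]; exact Real.Gamma_add_one hγ.ne'
  have hl1 : 0 < l - 1 := by linarith
  have hl0 : 0 < l := by linarith
  have hG0 : 0 < G := by rw [← hG]; positivity
  have hG1p : 0 < Real.Gamma (1 + γ) := by rw [hG1]; positivity
  refine le_sSup (exist_sol γ p A u₀ (l * u₀) _ hγ hγ1 (by linarith) hA hu₀ (by nlinarith)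
    (by positivity) ?_)
  rw [← Real.rpow_mul (by positivity), one_div_mul_cancel hγ.ne', Real.rpow_one,
    Real.mul_rpow hl0.le hu₀.le, hG1, ← hG]
  have e2 : u₀ ^ p = u₀ ^ (p - 1) * u₀ := by
    rw [← Real.rpow_add_one hu₀.ne']; ring_nf
  rw [e2]
  apply le_of_eq
  have : 0 < u₀ ^ (p - 1) := by positivity
  have : 0 < l ^ p := by positivity
  field_simp
  ring

/-- explicit two-sided bounds for the blow-up time. -/
theorem stmt12 (γ p A u₀ : ℝ)
    (hγ : γ ∈ Set.Ioo (0:ℝ) 1) (hp : 1 < p) (hA : 0 < A) (hu₀ : 0 < u₀)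
    (hfin : maxTime γ (fun x => A * x ^ p) (Set.Ioi 0) u₀ < ⊤) :
    ENNReal.ofReal ((Real.Gamma (1 + γ) /
        (A * u₀ ^ (p - 1) * min ((2:ℝ) ^ p) (p ^ p / (p - 1) ^ (p - 1)))) ^ (1 / γ))
      ≤ maxTime γ (fun x => A * x ^ p) (Set.Ioi 0) u₀ ∧
    maxTime γ (fun x => A * x ^ p) (Set.Ioi 0) u₀ ≤
      ENNReal.ofReal ((Real.Gamma (1 + γ) /
        (A * u₀ ^ (p - 1) * max (p - 1) ((2:ℝ) ^ (-(p * γ) / (p - 1))))) ^ (1 / γ)) := by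
  obtain ⟨hγ0, hγ1⟩ := hγ
  have hp1 : 0 < p - 1 := by linarith
  have hG1p : 0 < Real.Gamma (1 + γ) := Real.Gamma_pos_of_pos (by linarith)
  have hup : 0 < u₀ ^ (p - 1) := by positivity
  constructor
  · rcases min_choice ((2:ℝ) ^ p) (p ^ p / (p - 1) ^ (p - 1)) with h | h <;> rw [h]
    · exact lower_lam γ p A u₀ 2 _ hγ0 hγ1 hp hA hu₀ (by norm_num) (by norm_num)
    · refine lower_lam γ p A u₀ (p / (p - 1)) _ hγ0 hγ1 hp hA hu₀ ?_ ?_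
      · rw [lt_div_iff₀ hp1]; linarith
      · rw [Real.div_rpow (by linarith) hp1.le]
        have e2 : (p - 1) ^ p = (p - 1) ^ (p - 1) * (p - 1) := by
          rw [← Real.rpow_add_one hp1.ne']; ring_nf
        have : 0 < (p - 1) ^ (p - 1) := by positivity
        have e3 : p / (p - 1) - 1 = 1 / (p - 1) := by field_simp; ring
        rw [e2, e3]
        field_simp
  · refine sSup_le ?_
    rintro T ⟨u, hu⟩
    rcases max_choice (p - 1) ((2:ℝ) ^ (-(p * γ) / (p - 1))) with h | h <;> rw [h]
    · refine upper_p γ p A u₀ _ hγ0 hγ1 hp hA hu₀ (by positivity) ?_ T u hu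
      rw [← Real.rpow_mul (by positivity), one_div_mul_cancel hγ0.ne', Real.rpow_one]
      field_simp
    · refine upper_two γ p A u₀ _ hγ0 hp hA hu₀ (by positivity) ?_ T u hu
      rw [← Real.rpow_mul (by positivity), one_div_mul_cancel hγ0.ne', Real.rpow_one,
        neg_div, Real.rpow_neg (by norm_num)]
      have : 0 < (2:ℝ) ^ (p * γ / (p - 1)) := by positivity
      field_simp
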